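/- arXiv:1902.06402 — 2 statements merged into one kernel-verified Lean document; each statement's English description precedes it below -/
import Mathlib

section
/- Let G be an infinite locally finite connected graph and let (F_i)_{i=1}^∞ be a sequence of finite connected subgraphs of G with F_i a subgraph of F_{i+1} for all i. Set F = ⋃_{i=1}^∞ F_i and suppose that V(F) = V(G), and that for every i ≥ 1 and every component H of G − F_{i+1}, there is a component L of F_{i+1} − F_i (where for i = 1 we allow L = F_1) such that N_F(V(H)) ⊆ V(L). Then F is a faithful spanning subgraph of G. -/
namespace IGraph

open SimpleGraph

universe u w

variable {V : Type u} {W : Type w}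

/-- `G` is locally finite: every vertex has finite degree. -/
def LocFin (G : SimpleGraph V) : Prop := ∀ v : V, (G.neighborSet v).Finite

/-- A ray of `G`: a one-way infinite path, given by an injective sequence of
successively adjacent vertices. -/
def IsRay (G : SimpleGraph V) (R : ℕ → V) : Prop :=
  Function.Injective R ∧ ∀ n : ℕ, G.Adj (R n) (R (n + 1))

/-- `G − S`, kept on the same vertex type (removed vertices become isolated). -/
def del (G : SimpleGraph V) (S : Set V) : SimpleGraph V where
  Adj a b := G.Adj a b ∧ a ∉ S ∧ b ∉ S
  symm := ⟨fun a b h => ⟨h.1.symm, h.2.2, h.2.1⟩⟩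
  loopless := ⟨fun a h => G.loopless.irrefl a h.1⟩

/-- Two rays are equivalent in `G` if for every finite `S ⊆ V(G)` some component of
`G − S` contains a tail of both. -/
def RayEquiv (G : SimpleGraph V) (R₁ R₂ : ℕ → V) : Prop :=
  ∀ S : Set V, S.Finite →
    ∃ m n : ℕ, (∀ i, m ≤ i → R₁ i ∉ S) ∧ (∀ j, n ≤ j → R₂ j ∉ S) ∧
      (del G S).Reachable (R₁ m) (R₂ n)

/-- `F` is a faithful subgraph of `G` (both presented on the same vertex type):
(1) every end of `G` contains a ray of `F`, and (2) two rays of `F` are equivalent in `F`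
iff they are equivalent in `G`. -/
def Faithful (F G : SimpleGraph V) : Prop :=
  (∀ R : ℕ → V, IsRay G R → ∃ R' : ℕ → V, IsRay F R' ∧ RayEquiv G R R') ∧
  ∀ R₁ R₂ : ℕ → V, IsRay F R₁ → IsRay F R₂ → (RayEquiv F R₁ R₂ ↔ RayEquiv G R₁ R₂)

/-- `N_G(X)`: vertices outside `X` with a neighbor in `X`. -/
def NSet (G : SimpleGraph V) (X : Set V) : Set V := {y | y ∉ X ∧ ∃ x ∈ X, G.Adj x y}

/-- `Z_G(X)`: vertices of `X` with a neighbor outside `X`. -/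
def ZSet (G : SimpleGraph V) (X : Set V) : Set V := {x | x ∈ X ∧ ∃ y, y ∉ X ∧ G.Adj x y}

/-- The vertex set of the component of `G − S` containing `v`. -/
def compOf (G : SimpleGraph V) (S : Set V) (v : V) : Set V := {x | (del G S).Reachable v x}

/-- The degree of the end of `G` represented by the ray `R`: the supremum of the numbers of
pairwise vertex-disjoint rays equivalent to `R`. -/
noncomputable def endDegree (G : SimpleGraph V) (R : ℕ → V) : ℕ∞ :=
  ⨆ n ∈ {n : ℕ | ∃ f : Fin n → ℕ → V,
      (∀ i, IsRay G (f i) ∧ RayEquiv G (f i) R) ∧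
      ∀ i j, i ≠ j → Disjoint (Set.range (f i)) (Set.range (f j))}, (n : ℕ∞)

/-- `H` is `k`-connected: `|V(H)| > k` and removing fewer than `k` vertices leaves a
connected graph. -/
def IsKConn (k : ℕ) (H : SimpleGraph W) : Prop :=
  (k : Cardinal) < Cardinal.mk W ∧
    ∀ X : Set W, X.Finite → X.ncard < k → (H.induce Xᶜ).Connected

/-- Every vertex has degree at most 3. -/
def Subcubic (G : SimpleGraph V) : Prop :=
  ∀ v : V, (G.neighborSet v).Finite ∧ (G.neighborSet v).ncard ≤ 3

/-- Every vertex has degree exactly 3. -/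
def Cubic (G : SimpleGraph V) : Prop := ∀ v : V, (G.neighborSet v).ncard = 3

/-- `S` is 3-connected in `G`: every two vertices of `S` are joined by three pairwise
internally disjoint paths of `G`. -/
def ThreeConnIn (G : SimpleGraph V) (S : Set V) : Prop :=
  ∀ u v : V, u ∈ S → v ∈ S → u ≠ v →
    ∃ p₁ p₂ p₃ : G.Path u v,
      p₁ ≠ p₂ ∧ p₁ ≠ p₃ ∧ p₂ ≠ p₃ ∧
      (∀ x, x ∈ (p₁ : G.Walk u v).support → x ∈ (p₂ : G.Walk u v).support → x = u ∨ x = v) ∧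
      (∀ x, x ∈ (p₁ : G.Walk u v).support → x ∈ (p₃ : G.Walk u v).support → x = u ∨ x = v) ∧
      (∀ x, x ∈ (p₂ : G.Walk u v).support → x ∈ (p₃ : G.Walk u v).support → x = u ∨ x = v)

/-- A subgraph which is a (finite) cycle: finite, nonempty, connected and 2-regular. -/
def IsCycleSub {G : SimpleGraph W} (C : G.Subgraph) : Prop :=
  C.verts.Finite ∧ C.verts.Nonempty ∧ C.Connected ∧
    ∀ v ∈ C.verts, (C.neighborSet v).ncard = 2

/-- A cactus: a connected subcubic graph whose cycles are pairwise vertex-disjoint and whose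
edges decompose into vertex-disjoint cycles and vertex-disjoint paths (equivalently, every
vertex on no cycle has degree at most 2). -/
def IsCactus (H : SimpleGraph W) : Prop :=
  H.Connected ∧ Subcubic H ∧
  (∀ C₁ C₂ : H.Subgraph, IsCycleSub C₁ → IsCycleSub C₂ → C₁ ≠ C₂ →
    Disjoint C₁.verts C₂.verts) ∧
  ∀ v : W, (∀ C : H.Subgraph, IsCycleSub C → v ∉ C.verts) → (H.neighborSet v).ncard ≤ 2

/-- A semi-cactus: connected, maximum degree at most 4, every block is a cycle or a `K₂`
(equivalently, distinct cycles are edge-disjoint), and every vertex lies in at most two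
blocks (cycles through `v` together with bridges at `v` number at most 2). -/
def IsSemiCactus (H : SimpleGraph W) : Prop :=
  H.Connected ∧ (∀ v : W, (H.neighborSet v).Finite ∧ (H.neighborSet v).ncard ≤ 4) ∧
  (∀ C₁ C₂ : H.Subgraph, IsCycleSub C₁ → IsCycleSub C₂ → C₁ ≠ C₂ →
    Disjoint C₁.edgeSet C₂.edgeSet) ∧
  ∀ v : W,
    {C : H.Subgraph | IsCycleSub C ∧ v ∈ C.verts}.encard +
      {e : Sym2 W | e ∈ H.edgeSet ∧ v ∈ e ∧
        ∀ C : H.Subgraph, IsCycleSub C → e ∉ C.edgeSet}.encard ≤ 2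

/-- Every cycle of `H` is even. -/
def EvenCycles (H : SimpleGraph W) : Prop :=
  ∀ C : H.Subgraph, IsCycleSub C → Even C.verts.ncard

/-- `v` is a cut-vertex of `H`: removing `v` separates two vertices. -/
def IsCutVert (H : SimpleGraph W) (v : W) : Prop :=
  ∃ a b : W, a ≠ v ∧ b ≠ v ∧ H.Reachable a b ∧ ¬ (del H {v}).Reachable a b

/-- `H` is non-separable: connected without cut-vertices. -/
def Nonseparable (H : SimpleGraph W) : Prop := H.Connected ∧ ∀ v : W, ¬ IsCutVert H v

/-- `B` is the vertex set of a block of `H`: a maximal set inducing a non-separable graph. -/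
def IsBlockSet (H : SimpleGraph W) (B : Set W) : Prop :=
  Nonseparable (H.induce B) ∧ ∀ B' : Set W, B ⊆ B' → Nonseparable (H.induce B') → B' = B

/-- An end-block: a block containing at most one cut-vertex of `H`. -/
def IsEndBlock (H : SimpleGraph W) (B : Set W) : Prop :=
  IsBlockSet H B ∧ {v ∈ B | IsCutVert H v}.encard ≤ 1

/-- A block-chain: a connected graph whose block-cut tree is a path, i.e. every block
contains at most two cut-vertices and every cut-vertex lies in at most two blocks. -/
def IsBlockChain (H : SimpleGraph W) : Prop :=
  H.Connected ∧
  (∀ B : Set W, IsBlockSet H B → {v ∈ B | IsCutVert H v}.encard ≤ 2) ∧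
  ∀ v : W, IsCutVert H v → {B : Set W | IsBlockSet H B ∧ v ∈ B}.encard ≤ 2

/-- A block-chain connecting `u` and `v`: either `H` is non-separable, or `H` is separable
and `u`, `v` are non-cut vertices of two distinct end-blocks. -/
def BlockChainConn (H : SimpleGraph W) (u v : W) : Prop :=
  IsBlockChain H ∧
  (Nonseparable H ∨
    ((∃ x, IsCutVert H x) ∧
      ∃ B₁ B₂ : Set W, IsEndBlock H B₁ ∧ IsEndBlock H B₂ ∧ B₁ ≠ B₂ ∧
        u ∈ B₁ ∧ v ∈ B₂ ∧ ¬ IsCutVert H u ∧ ¬ IsCutVert H v))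

/-- The `k`-th power of `G`: vertices at distance at most `k` become adjacent. -/
def gpow (G : SimpleGraph V) (k : ℕ) : SimpleGraph V where
  Adj u v := u ≠ v ∧ ∃ p : G.Walk u v, p.length ≤ k
  symm := ⟨fun u v h => ⟨h.1.symm, by obtain ⟨p, hp⟩ := h.2; exact ⟨p.reverse, by simpa using hp⟩⟩⟩
  loopless := ⟨fun v h => h.1 rfl⟩

/-- The copy `G × {d₀}` of `G` inside the Cartesian product `G □ D`. -/
def copyAt (G : SimpleGraph V) (d₀ : W) : SimpleGraph (V × W) where
  Adj p q := G.Adj p.1 q.1 ∧ p.2 = d₀ ∧ q.2 = d₀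
  symm := ⟨fun p q h => ⟨h.1.symm, h.2.2, h.2.1⟩⟩
  loopless := ⟨fun p h => G.loopless.irrefl _ h.1⟩

/-- The line graph of the subgraph `F` of `G`, presented on the vertex set `E(G)` of the
line graph of `G` (edges of `G` not in `F` are isolated). -/
def lineSub (G F : SimpleGraph V) : SimpleGraph G.edgeSet where
  Adj e f := (e : Sym2 V) ∈ F.edgeSet ∧ (f : Sym2 V) ∈ F.edgeSet ∧ e ≠ f ∧
    ∃ x : V, x ∈ (e : Sym2 V) ∧ x ∈ (f : Sym2 V)
  symm := ⟨fun e f h =>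
    ⟨h.2.1, h.1, h.2.2.1.symm, by obtain ⟨x, h1, h2⟩ := h.2.2.2; exact ⟨x, h2, h1⟩⟩⟩
  loopless := ⟨fun e h => h.2.2.1 rfl⟩

/-- `B ⊆ V(G)` induces a cycle of `G`. -/
def IsCycleSet (G : SimpleGraph V) (B : Set V) : Prop :=
  B.Finite ∧ B.Nonempty ∧ (G.induce B).Connected ∧
    ∀ v ∈ B, (G.neighborSet v ∩ B).ncard = 2

/-- A vertex reachable in `G − S` from a vertex outside `S` is itself outside `S`. -/
theorem notMem_of_reachable_del {G : SimpleGraph V} {S : Set V} {a b : V} (ha : a ∉ S)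
    (h : (del G S).Reachable a b) : b ∉ S := by
  rw [SimpleGraph.reachable_iff_reflTransGen] at h
  induction h with
  | refl => exact ha
  | tail _ hbc _ => exact hbc.2.2

theorem reachable_del_mono {G H : SimpleGraph V} {S T : Set V} (hGH : G ≤ H) (hST : T ⊆ S)
    {a b : V} (h : (del G S).Reachable a b) : (del H T).Reachable a b :=
  h.mono fun _ _ (hab : (del G S).Adj _ _) =>
    ⟨hGH hab.1, fun h => hab.2.1 (hST h), fun h => hab.2.2 (hST h)⟩

theorem RayEquiv.mono {G H : SimpleGraph V} (hGH : G ≤ H) {R₁ R₂ : ℕ → V}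
    (h : RayEquiv G R₁ R₂) : RayEquiv H R₁ R₂ := fun S hS =>
  let ⟨m, n, hm, hn, hr⟩ := h S hS
  ⟨m, n, hm, hn, reachable_del_mono hGH subset_rfl hr⟩

/-- A ray eventually leaves every finite set of vertices. -/
theorem IsRay.exists_tail_avoiding {G : SimpleGraph V} {R : ℕ → V} (hR : IsRay G R) {S : Set V}
    (hS : S.Finite) : ∃ m, ∀ i, m ≤ i → R i ∉ S := by
  obtain ⟨m, hm⟩ := (hS.preimage hR.1.injOn).bddAbove
  exact ⟨m + 1, fun i hi hiS => absurd (hm hiS) (by omega)⟩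

/-- Following a walk of `U` that leaves the component of `G − B` containing `a`, one reaches
`N_U` of that component while avoiding `S ⊆ B`. -/
theorem exists_reachable_mem_nset {U G : SimpleGraph V} {S B : Set V} {a : V}
    (hSB : S ⊆ B) (ha : a ∉ B) (hS : ∀ y ∈ NSet U (compOf G B a), y ∉ S) {x b : V}
    (p : U.Walk x b) (hx : x ∈ compOf G B a) (hb : b ∉ compOf G B a) :
    ∃ y ∈ NSet U (compOf G B a), (del U S).Reachable x y := by
  induction p with
  | nil => exact absurd hx hb
  | @cons x z b hxz p ih =>
    have hxB : x ∉ B := notMem_of_reachable_del ha hx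
    have hxS : x ∉ S := fun h => hxB (hSB h)
    by_cases hz : z ∈ compOf G B a
    · obtain ⟨y, hy, hr⟩ := ih hz hb
      have hzS : z ∉ S := fun h => notMem_of_reachable_del ha hz (hSB h)
      have hadj : (del U S).Adj x z := ⟨hxz, hxS, hzS⟩
      exact ⟨y, hy, hadj.reachable.trans hr⟩
    · have hzN : z ∈ NSet U (compOf G B a) := ⟨hz, x, hx, hxz⟩
      have hadj : (del U S).Adj x z := ⟨hxz, hxS, hS z hzN⟩
      exact ⟨z, hzN, hadj.reachable⟩

/-- A geodesic from `r` through `v` to `x ≠ v` leaves `v` through a neighbor one further away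
from `r`. -/
theorem exists_adj_geodesic {U : SimpleGraph V} (hU : U.Connected) {r v x : V} (hvx : v ≠ x)
    (h : U.dist r x = U.dist r v + U.dist v x) :
    ∃ w, U.Adj v w ∧ U.dist r w = U.dist r v + 1 ∧ U.dist v x = U.dist w x + 1 ∧
      U.dist r x = U.dist r w + U.dist w x := by
  obtain ⟨p, hp⟩ := hU.exists_walk_length_eq_dist v x
  cases p with
  | nil => exact absurd rfl hvx
  | @cons _ w _ hvw p =>
    have h1 : U.dist w x ≤ p.length := SimpleGraph.dist_le p
    have h2 : U.dist r x ≤ U.dist r w + U.dist w x := hU.dist_triangle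
    have h3 : U.dist r w ≤ U.dist r v + U.dist v w := hU.dist_triangle
    have h4 : U.dist v w = 1 := SimpleGraph.dist_eq_one_iff_adj.mpr hvw
    rw [SimpleGraph.Walk.length_cons] at hp
    exact ⟨w, hvw, by omega, by omega, by omega⟩

theorem reachable_del_of_geodesic {U : SimpleGraph V} (hU : U.Connected) {r x : V} {S : Set V} :
    ∀ {v : V}, (∀ s ∈ S, U.dist r s < U.dist r v) →
      U.dist r x = U.dist r v + U.dist v x → (del U S).Reachable v x := by
  intro v
  induction hn : U.dist v x generalizing v with
  | zero =>
    intro _ _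
    rw [hU.dist_eq_zero_iff.mp hn]
  | succ n ih =>
    intro hS h
    have hvx : v ≠ x := by
      rintro rfl
      simp at hn
    obtain ⟨w, hvw, h1, h2, h3⟩ := exists_adj_geodesic (r := r) hU hvx (by omega)
    have hadj : (del U S).Adj v w :=
      ⟨hvw, fun hv => lt_irrefl _ (hS v hv), fun hw => absurd (hS w hw) (by omega)⟩
    exact hadj.reachable.trans
      (ih (by omega) (fun s hs => (hS s hs).trans (by omega)) (by omega))

/-- In a connected locally finite graph, every infinite set `X` of vertices admits a geodesic ray
each of whose vertices lies on geodesics from the origin to infinitely many elements of `X`. -/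
theorem exists_geodesic_ray {U : SimpleGraph V} (hU : U.Connected) (hlf : LocFin U) {X : Set V}
    (hX : X.Infinite) (r : V) :
    ∃ Q : ℕ → V, IsRay U Q ∧ (∀ n, U.dist r (Q n) = n) ∧
      ∀ n, {x ∈ X | U.dist r x = U.dist r (Q n) + U.dist (Q n) x}.Infinite := by
  have step : ∀ v, {x ∈ X | U.dist r x = U.dist r v + U.dist v x}.Infinite →
      ∃ w, U.Adj v w ∧ U.dist r w = U.dist r v + 1 ∧
        {x ∈ X | U.dist r x = U.dist r w + U.dist w x}.Infinite := by
    intro v hv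
    by_contra! hcon
    refine hv (((Set.finite_singleton v).union (((hlf v).subset
      (t := {w | U.Adj v w ∧ U.dist r w = U.dist r v + 1}) fun w hw => hw.1).biUnion
      (t := fun w => {x ∈ X | U.dist r x = U.dist r w + U.dist w x})
      fun w hw => ?_)).subset ?_)
    · exact hcon w hw.1 hw.2
    · rintro x ⟨hxX, hx⟩
      rcases eq_or_ne v x with rfl | hvx
      · exact Or.inl rfl
      · obtain ⟨w, hvw, h1, -, h3⟩ := exists_adj_geodesic hU hvx hx
        exact Or.inr (Set.mem_biUnion (x := w) ⟨hvw, h1⟩ ⟨hxX, h3⟩)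
  choose! f hadj hdist hinf using step
  let Q : ℕ → V := fun n => f^[n] r
  have hsucc : ∀ n, Q (n + 1) = f (Q n) := fun n => Function.iterate_succ_apply' f n r
  have hQ : ∀ n, {x ∈ X | U.dist r x = U.dist r (Q n) + U.dist (Q n) x}.Infinite := by
    intro n
    induction n with
    | zero => simpa [Q] using hX
    | succ n ih => rw [hsucc]; exact hinf _ ih
  have hd : ∀ n, U.dist r (Q n) = n := by
    intro n
    induction n with
    | zero => simp [Q]
    | succ n ih => rw [hsucc, hdist _ (hQ n), ih]
  refine ⟨Q, ⟨fun m n hmn => ?_, fun n => ?_⟩, hd, hQ⟩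
  · rw [← hd m, ← hd n, hmn]
  · rw [hsucc]
    exact hadj _ (hQ n)

/-- A connected locally finite spanning subgraph contains a ray of every end. -/
theorem exists_ray_equiv {U G : SimpleGraph V} (hUG : U ≤ G) (hU : U.Connected)
    (hlf : LocFin U) {R : ℕ → V} (hR : IsRay G R) :
    ∃ R', IsRay U R' ∧ RayEquiv G R R' := by
  obtain ⟨Q, hQray, hd, hQ⟩ :=
    exists_geodesic_ray hU hlf (Set.infinite_range_of_injective hR.1) (R 0)
  refine ⟨Q, hQray, fun S hS => ?_⟩
  obtain ⟨m, hm⟩ := hR.exists_tail_avoiding hS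
  obtain ⟨N, hN⟩ := (hS.image (U.dist (R 0))).bddAbove
  have hlt : ∀ s ∈ S, U.dist (R 0) s < U.dist (R 0) (Q (N + 1)) := fun s hs => by
    rw [hd]
    exact Nat.lt_succ_of_le (hN ⟨s, hs, rfl⟩)
  obtain ⟨x, ⟨⟨k, rfl⟩, hx⟩, hk⟩ :=
    (hQ (N + 1)).exists_notMem_finite ((Set.finite_Iio m).image R)
  have hmk : m ≤ k := by
    by_contra! h
    exact hk ⟨k, h, rfl⟩
  refine ⟨k, N + 1, fun i hi => hm i (hmk.trans hi), fun j hj hjS => ?_,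
    (reachable_del_mono hUG subset_rfl (reachable_del_of_geodesic hU hlt hx)).symm⟩
  have h := hlt _ hjS
  rw [hd, hd] at h
  omega

/-- A spanning union of an increasing sequence of connected subgraphs is connected. -/
theorem connected_spanningCoe_iSup {G : SimpleGraph V} (F : ℕ → G.Subgraph)
    (hc : ∀ i, (F i).Connected) (hmono : Monotone F)
    (hspan : (⨆ j, F j : G.Subgraph).IsSpanning) :
    (⨆ j, F j : G.Subgraph).spanningCoe.Connected := by
  have hex : ∀ v, ∃ i, v ∈ (F i).verts := fun v => by simpa using hspan v
  obtain ⟨v₀, _⟩ := (hc 0).nonempty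
  have : Nonempty V := ⟨v₀⟩
  refine ⟨fun a b => ?_⟩
  obtain ⟨i, hi⟩ := hex a
  obtain ⟨j, hj⟩ := hex b
  have ha : a ∈ (F (max i j)).verts := (hmono (le_max_left i j)).1 hi
  have hb : b ∈ (F (max i j)).verts := (hmono (le_max_right i j)).1 hj
  let φ : (F (max i j)).coe →g (⨆ j, F j : G.Subgraph).spanningCoe :=
    ⟨Subtype.val, fun {_ _} h => (le_iSup F (max i j)).2 h⟩
  exact ((hc (max i j)).coe ⟨a, ha⟩ ⟨b, hb⟩).map φ

/-- If `(F i)` is an increasing sequence of finite connected subgraphs of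
`G` whose union `F` is spanning, and every component `H` of `G − F (i+1)` has
`N_F(V(H))` inside the vertex set of one component `L` of `F (i+1) − F i` (for `i = 0`,
i.e. the first index, `L = F 0` is also allowed), then `F` is a faithful spanning
subgraph of `G`. -/
theorem union_faithful_spanning' {V : Type u} (G : SimpleGraph V)
    (hinf : Infinite V) (hlf : LocFin G) (hconn : G.Connected)
    (F : ℕ → G.Subgraph)
    (hfin : ∀ i, (F i).verts.Finite) (hc : ∀ i, (F i).Connected)
    (hmono : ∀ i, F i ≤ F (i + 1))
    (hspan : (⨆ j, F j : G.Subgraph).IsSpanning)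
    (hcomp : ∀ i, ∀ v, v ∉ (F (i + 1)).verts →
      (∃ d, d ∈ (F (i + 1)).verts ∧ d ∉ (F i).verts ∧
        NSet (⨆ j, F j : G.Subgraph).spanningCoe (compOf G (F (i + 1)).verts v) ⊆
          compOf (F (i + 1)).spanningCoe (F i).verts d) ∨
      (i = 0 ∧
        NSet (⨆ j, F j : G.Subgraph).spanningCoe (compOf G (F (i + 1)).verts v) ⊆
          (F 0).verts)) :
    (⨆ j, F j : G.Subgraph).IsSpanning ∧
      Faithful (⨆ j, F j : G.Subgraph).spanningCoe G := by
  have hM : Monotone F := monotone_nat_of_le_succ hmono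
  have hconnU := connected_spanningCoe_iSup F hc hM hspan
  have hex : ∀ v, ∃ i, v ∈ (F i).verts := fun v => by simpa using hspan v
  have hFU : ∀ i, (F i).spanningCoe ≤ (⨆ j, F j : G.Subgraph).spanningCoe :=
    fun i _ _ h => (le_iSup F i).2 h
  have hUG := (⨆ j, F j : G.Subgraph).spanningCoe_le
  generalize (⨆ j, F j : G.Subgraph).spanningCoe = U at hcomp hconnU hFU hUG ⊢
  refine ⟨hspan, fun R hR =>
    exists_ray_equiv hUG hconnU (fun v => (hlf v).subset fun w hw => hUG hw) hR,
    fun R₁ R₂ _ _ => ⟨RayEquiv.mono hUG, fun hG S hS => ?_⟩⟩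
  choose f hf using hex
  obtain ⟨N, hN⟩ := (hS.image f).bddAbove
  have hSN : S ⊆ (F (N + 1)).verts := fun v hv =>
    (hM ((hN ⟨v, hv, rfl⟩).trans N.le_succ)).1 (hf v)
  have hSN' : S ⊆ (F (N + 1 + 1)).verts := hSN.trans (hmono _).1
  obtain ⟨m, n, hm, hn, hr⟩ := hG _ (hfin (N + 1 + 1))
  have ha := hm m le_rfl
  obtain ⟨d, -, hd, hNd⟩ | ⟨h0, -⟩ := hcomp (N + 1) (R₁ m) ha
  swap
  · omega
  obtain ⟨b, hb⟩ := (hc (N + 1 + 1)).nonempty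
  have hbC : b ∉ compOf G (F (N + 1 + 1)).verts (R₁ m) :=
    fun h => notMem_of_reachable_del ha h hb
  have hNS : ∀ y ∈ NSet U (compOf G (F (N + 1 + 1)).verts (R₁ m)), y ∉ S :=
    fun y hy hyS => notMem_of_reachable_del hd (hNd hy) (hSN hyS)
  have key : ∀ x ∈ compOf G (F (N + 1 + 1)).verts (R₁ m), (del U S).Reachable x d := by
    intro x hx
    obtain ⟨p⟩ := hconnU x b
    obtain ⟨y, hy, hxy⟩ := exists_reachable_mem_nset hSN' ha hNS p hx hbC
    exact hxy.trans (reachable_del_mono (hFU _) hSN (hNd hy)).symm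
  exact ⟨m, n, fun i hi h => hm i hi (hSN' h), fun j hj h => hn j hj (hSN' h),
    (key _ (SimpleGraph.Reachable.refl _)).trans (key _ hr).symm⟩

end IGraph
end

section
/- Let G be an infinite locally finite connected graph, D a finite connected graph, and G' = G □ D. Let α be an end of G and α' the end of G' such that every ray of the copy G × {d₀} of G (for a fixed vertex d₀ of D) belonging to α belongs to α'. Then d(α') = d(α) · |V(D)|. -/
namespace IGraph

open SimpleGraph

universe u w

variable {V : Type u} {W : Type w}

/-- The vertex set of the component of `G − S` containing a tail of `R`. -/
def endComp (G : SimpleGraph V) (R : ℕ → V) (S : Set V) : Set V :=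
  {v | ∃ m, (∀ i, m ≤ i → R i ∉ S) ∧ (del G S).Reachable v (R m)}

section EndComp

variable {G : SimpleGraph V} {R : ℕ → V} {S T : Set V} {u v : V}

theorem IsRay.exists_tail_notMem (hR : IsRay G R) (hS : S.Finite) :
    ∃ m, ∀ i, m ≤ i → R i ∉ S := by
  obtain ⟨m, hm⟩ := (hS.preimage hR.1.injOn).bddAbove
  exact ⟨m + 1, fun i hi h => absurd (hm h) (by omega)⟩

theorem IsRay.del_reachable (hR : IsRay G R) {m n : ℕ} (hm : ∀ i, m ≤ i → R i ∉ S)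
    (hmn : m ≤ n) : (del G S).Reachable (R m) (R n) := by
  induction n, hmn using Nat.le_induction with
  | base => exact Reachable.refl _
  | succ k hk ih =>
    have h : (del G S).Adj (R k) (R (k + 1)) := ⟨hR.2 k, hm k hk, hm (k + 1) (by omega)⟩
    exact ih.trans h.reachable

theorem notMem_of_mem_endComp (h : v ∈ endComp G R S) : v ∉ S := by
  obtain ⟨m, hm, ⟨p⟩⟩ := h
  cases p with
  | nil => exact hm m le_rfl
  | cons h _ => exact h.2.1

theorem mem_endComp_of_reachable (hu : u ∈ endComp G R S) (h : (del G S).Reachable u v) :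
    v ∈ endComp G R S := by
  obtain ⟨m, hm, hr⟩ := hu
  exact ⟨m, hm, h.symm.trans hr⟩

theorem mem_endComp_of_adj (hu : u ∈ endComp G R S) (h : G.Adj u v) (hv : v ∉ S) :
    v ∈ endComp G R S := by
  have h' : (del G S).Adj u v := ⟨h, notMem_of_mem_endComp hu, hv⟩
  exact mem_endComp_of_reachable hu h'.reachable

theorem IsRay.exists_tail_mem_endComp (hR : IsRay G R) (hS : S.Finite) :
    ∃ m, ∀ i, m ≤ i → R i ∈ endComp G R S := by
  obtain ⟨m, hm⟩ := hR.exists_tail_notMem hS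
  exact ⟨m, fun i hi => ⟨m, hm, (hR.del_reachable hm hi).symm⟩⟩

theorem IsRay.reachable_of_mem_endComp (hR : IsRay G R) (hu : u ∈ endComp G R S)
    (hv : v ∈ endComp G R S) : (del G S).Reachable u v := by
  obtain ⟨m, hm, hum⟩ := hu
  obtain ⟨n, hn, hvn⟩ := hv
  exact (hum.trans (hR.del_reachable hm (le_max_left m n))).trans
    (hvn.trans (hR.del_reachable hn (le_max_right m n))).symm

theorem IsRay.reachable_of_disjoint (hR : IsRay G R) (hST : Disjoint S (endComp G R T))
    (hu : u ∈ endComp G R T) (hv : v ∈ endComp G R T) : (del G S).Reachable u v := by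
  obtain ⟨p⟩ := hR.reachable_of_mem_endComp hu hv
  induction p with
  | nil => exact Reachable.refl _
  | @cons a b c h p ih =>
    have hb := mem_endComp_of_adj hu h.1 h.2.2
    have h' : (del G S).Adj a b :=
      ⟨h.1, hST.notMem_of_mem_right hu, hST.notMem_of_mem_right hb⟩
    exact h'.reachable.trans (ih hb hv)

theorem IsRay.endComp_subset (hR : IsRay G R) (hT : T.Finite)
    (hST : Disjoint S (endComp G R T)) : endComp G R T ⊆ endComp G R S := by
  intro v hv
  obtain ⟨m, hm⟩ := hR.exists_tail_mem_endComp hT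
  exact ⟨m, fun i hi => hST.notMem_of_mem_right (hm i hi),
    hR.reachable_of_disjoint hST hv (hm m le_rfl)⟩

/-- Deleting from a finite `S` the vertices without a neighbour in its end component does not
enlarge that component. -/
theorem IsRay.endComp_boundary_subset (hR : IsRay G R) (hS : S.Finite) :
    endComp G R {b ∈ S | ∃ c ∈ endComp G R S, G.Adj c b} ⊆ endComp G R S := by
  intro v hv
  obtain ⟨m, hm⟩ := hR.exists_tail_mem_endComp hS
  have hS' : {b ∈ S | ∃ c ∈ endComp G R S, G.Adj c b}.Finite := hS.subset fun b hb => hb.1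
  obtain ⟨m', hm'⟩ := hR.exists_tail_mem_endComp hS'
  obtain ⟨p⟩ := hR.reachable_of_mem_endComp (hm' _ (le_max_right m m')) hv
  have key : ∀ a w, a ∈ endComp G R S →
      (del G {b ∈ S | ∃ c ∈ endComp G R S, G.Adj c b}).Walk a w → w ∈ endComp G R S := by
    intro a w ha p
    induction p with
    | nil => exact ha
    | cons h p ih =>
      exact ih (mem_endComp_of_adj ha h.1 fun hb => h.2.2 ⟨hb, _, ha, h.1⟩)
  exact key _ _ (hm _ (le_max_left m m')) p

/-- A minimum set separating `X` from the end of `R`; each of its vertices has a neighbour in the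
component of that end. -/
theorem IsRay.exists_min_separator (hR : IsRay G R) (X : Finset V) :
    ∃ S : Finset V, Disjoint (X : Set V) (endComp G R S) ∧
      (∀ T : Finset V, Disjoint (X : Set V) (endComp G R T) → S.card ≤ T.card) ∧
      ∀ b ∈ S, ∃ c ∈ endComp G R S, G.Adj c b := by
  classical
  have hX : Disjoint (X : Set V) (endComp G R X) :=
    Set.disjoint_right.2 fun v hv => notMem_of_mem_endComp hv
  have hex : ∃ n, ∃ S : Finset V, S.card = n ∧ Disjoint (X : Set V) (endComp G R S) :=
    ⟨_, X, rfl, hX⟩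
  obtain ⟨S, hc, hS⟩ := Nat.find_spec hex
  have hmin : ∀ T : Finset V, Disjoint (X : Set V) (endComp G R T) → S.card ≤ T.card :=
    fun T hT => hc ▸ Nat.find_min' hex ⟨T, rfl, hT⟩
  refine ⟨S, hS, hmin, ?_⟩
  have hsub := hR.endComp_boundary_subset S.finite_toSet
  have hle := hmin (S.filter fun b => ∃ c ∈ endComp G R S, G.Adj c b) (by
    refine hS.mono_right ?_
    simpa [Finset.coe_filter] using hsub)
  have heq := Finset.eq_of_subset_of_card_le (Finset.filter_subset _ S) hle
  exact Finset.filter_eq_self.1 heq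

end EndComp

/-- If no set of fewer than `k` elements meets every member of `P`, then this is already the case
for the members of `P` inside some finite set. -/
theorem exists_finset_forall_disjoint (P : Set (Finset V)) (k : ℕ)
    (hP : ∀ T : Finset V, T.card < k → ∃ p ∈ P, Disjoint p T) :
    ∃ U : Finset V, ∀ T : Finset V, T.card < k → ∃ p ∈ P, p ⊆ U ∧ Disjoint p T := by
  classical
  have key : ∀ j : ℕ, ∀ F : Finset V, F.card + j ≤ k → ∃ U : Finset V,
      ∀ T : Finset V, F ⊆ T → (T \ F).card < j → ∃ p ∈ P, p ⊆ U ∧ Disjoint p T := by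
    intro j
    induction j with
    | zero => exact fun F _ => ⟨∅, fun T _ h => absurd h (by omega)⟩
    | succ j ih =>
      intro F hF
      obtain ⟨p, hp, hpF⟩ := hP F (by omega)
      choose U hU using fun t : V => ih (insert t F)
      have hcard : ∀ t, (insert t F).card + j ≤ k := fun t => by
        have := Finset.card_insert_le t F
        omega
      refine ⟨p ∪ p.biUnion fun t => U t (hcard t), fun T hFT hT => ?_⟩
      by_cases hd : Disjoint p T
      · exact ⟨p, hp, Finset.subset_union_left, hd⟩
      · obtain ⟨t, htp, htT⟩ := Finset.not_disjoint_iff.1 hd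
        have htF : t ∉ F := Finset.disjoint_left.1 hpF htp
        obtain ⟨q, hq, hqU, hqT⟩ := hU t (hcard t) T (Finset.insert_subset htT hFT) (by
          have h1 := Finset.card_sdiff_of_subset hFT
          have h2 := Finset.card_sdiff_of_subset (Finset.insert_subset htT hFT)
          rw [Finset.card_insert_of_notMem htF] at h2
          have h3 : 0 < (T \ F).card := Finset.card_pos.2 ⟨t, by simp [htT, htF]⟩
          omega)
        exact ⟨q, hq, hqU.trans ((Finset.subset_biUnion_of_mem (fun t => U t (hcard t)) htp).trans
          Finset.subset_union_right), hqT⟩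
  obtain ⟨U, hU⟩ := key k ∅ (by simp)
  exact ⟨U, fun T hT => hU T (Finset.empty_subset _) (by simpa using hT)⟩

/-- Menger's theorem in a finite vertex set `U`, in the form of a linkage of `A` into `B` given by
its successor function. -/
theorem exists_linkage (G : SimpleGraph V) (U A B : Finset V)
    (h : ∀ T : Finset V, T.card < A.card →
      ∃ a ∈ A, ∃ b ∈ B, ∃ p : G.Walk a b, ∀ v ∈ p.support, v ∈ U ∧ v ∉ T) :
    ∃ f : V → V, Set.InjOn f {v | v ∈ U ∧ v ∉ B} ∧
      ∀ v ∈ U, v ∉ B → f v ∈ U ∧ f v ∉ A ∧ (f v = v ∨ G.Adj v (f v)) := by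
  classical
  let N : V → Finset V := fun v => U.filter fun w => w = v ∨ G.Adj v w
  have hall : ∀ X : Finset {v // v ∈ U \ B}, X.card ≤ (X.biUnion fun v => N v \ A).card := by
    intro X
    by_contra! hlt
    let Y : Finset V := X.map (Function.Embedding.subtype _)
    have hYU : ∀ v ∈ Y, v ∈ U ∧ v ∉ B := fun v hv => by
      obtain ⟨x, -, rfl⟩ := Finset.mem_map.1 hv
      exact Finset.mem_sdiff.1 x.2
    have hYN : Y ⊆ Y.biUnion N := fun v hv =>
      Finset.mem_biUnion.2 ⟨v, hv, by simp [N, (hYU v hv).1]⟩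
    have hbi : (X.biUnion fun v => N v \ A) = Y.biUnion N \ A := by
      ext w
      simp only [Y, Finset.mem_biUnion, Finset.mem_sdiff, Finset.mem_map]
      aesop
    have hY : (Y.biUnion N \ A).card < Y.card := by
      rw [← hbi, Finset.card_map]
      exact hlt
    obtain ⟨a, ha, b, hb, p, hp⟩ := h ((Y.biUnion N \ Y) ∪ (A \ Y.biUnion N)) (by
      have h1 := Finset.card_union_le (Y.biUnion N \ Y) (A \ Y.biUnion N)
      have h2 := Finset.card_sdiff_add_card_inter (Y.biUnion N) A
      have h3 := Finset.card_sdiff_add_card_inter A (Y.biUnion N)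
      have h4 := Finset.card_sdiff_of_subset hYN
      have h5 := Finset.card_le_card hYN
      rw [Finset.inter_comm] at h3
      omega)
    have key : ∀ c d, ∀ q : G.Walk c d,
        (∀ v ∈ q.support, v ∈ U ∧ v ∉ (Y.biUnion N \ Y) ∪ (A \ Y.biUnion N)) →
        c ∈ Y → d ∈ Y := by
      intro c d q hq hc
      induction q with
      | nil => exact hc
      | @cons x y z hxy q ih =>
        refine ih (fun v hv => hq v (by simp [hv])) ?_
        have hy := hq y (by simp)
        by_contra hyY
        exact hy.2 (Finset.mem_union_left _ (Finset.mem_sdiff.2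
          ⟨Finset.mem_biUnion.2 ⟨x, hc, by simp [N, hy.1, hxy]⟩, hyY⟩))
    have haT := (hp a (by simp)).2
    have haY : a ∈ Y := by
      simp only [Finset.mem_union, Finset.mem_sdiff] at haT
      tauto
    exact (hYU b (key a b p hp haY)).2 hb
  obtain ⟨f, hf, hfm⟩ := (Finset.all_card_le_biUnion_card_iff_exists_injective _).1 hall
  refine ⟨fun v => if hv : v ∈ U \ B then f ⟨v, hv⟩ else v, ?_, ?_⟩
  · intro x hx y hy hxy
    have hx' : x ∈ U \ B := by simpa using hx
    have hy' : y ∈ U \ B := by simpa using hy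
    simp only [hx', hy', dif_pos] at hxy
    simpa using hf hxy
  · intro v hv hvB
    have hv' : v ∈ U \ B := by simp [hv, hvB]
    have := hfm ⟨v, hv'⟩
    simp only [hv', dif_pos]
    simp only [N, Finset.mem_sdiff, Finset.mem_filter] at this
    tauto

theorem exists_walk_from_separator {G : SimpleGraph V} {R : ℕ → V} {S : Set V} {Q : V → Prop}
    {x y : V} (p : G.Walk x y) (hy : y ∈ endComp G R S) (hp : ∀ v ∈ p.support, Q v) :
    (∀ v ∈ p.support, v ∈ endComp G R S) ∨
      ∃ a ∈ S, ∃ q : G.Walk a y, ∀ v ∈ q.support, (v ∈ S ∨ v ∈ endComp G R S) ∧ Q v := by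
  induction p with
  | nil => exact Or.inl (by simpa using hy)
  | @cons x w y h p ih =>
    rcases ih hy fun v hv => hp v (by simp [hv]) with hC | hq
    · by_cases hx : x ∈ S
      · refine Or.inr ⟨x, hx, Walk.cons h p, fun v hv => ⟨?_, hp v hv⟩⟩
        rcases (by simpa using hv : v = x ∨ v ∈ p.support) with rfl | hv
        · exact Or.inl hx
        · exact Or.inr (hC v hv)
      · left
        intro v hv
        rcases (by simpa using hv : v = x ∨ v ∈ p.support) with rfl | hv
        · exact mem_endComp_of_adj (hC w (by simp)) h.symm hx
        · exact hC v hv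
    · exact Or.inr hq

theorem exists_walk_to_separator {G : SimpleGraph V} {R : ℕ → V} {S : Set V} {Q : V → Prop}
    {x y : V} (p : G.Walk x y) (hx : x ∉ endComp G R S) (hy : y ∈ endComp G R S)
    (hp : ∀ v ∈ p.support, Q v) :
    ∃ b ∈ S, ∃ q : G.Walk x b, ∀ v ∈ q.support, Q v ∧ v ∉ endComp G R S := by
  induction p with
  | nil => exact absurd hy hx
  | @cons x w y h p ih =>
    by_cases hxS : x ∈ S
    · exact ⟨x, hxS, Walk.nil, by simpa using ⟨hp x (by simp), hx⟩⟩
    · obtain ⟨b, hb, q, hq⟩ := ih (fun hw => hx (mem_endComp_of_adj hw h.symm hxS)) hy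
        fun v hv => hp v (by simp [hv])
      refine ⟨b, hb, Walk.cons h q, fun v hv => ?_⟩
      rcases (by simpa using hv : v = x ∨ v ∈ q.support) with rfl | hv
      · exact ⟨hp v (by simp), hx⟩
      · exact hq v hv

theorem IsRay.exists_walk_between {G : SimpleGraph V} {R : ℕ → V} (hR : IsRay G R)
    {S S' T : Set V} (hS' : S'.Finite) (hT : T.Finite) (hSS' : Disjoint S (endComp G R S'))
    {x : V} (hxS : x ∉ endComp G R S) (hxT : x ∈ endComp G R T) :
    ∃ a ∈ S, ∃ b ∈ S', ∃ p : G.Walk a b, ∀ v ∈ p.support,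
      ((v ∈ S ∨ v ∈ endComp G R S) ∧ v ∉ T) ∧ v ∉ endComp G R S' := by
  classical
  obtain ⟨m, hm⟩ := hR.exists_tail_mem_endComp hS'
  obtain ⟨n, hn⟩ := hR.exists_tail_mem_endComp hT
  have hy := hm _ (le_max_left m n)
  obtain ⟨p⟩ := hR.reachable_of_mem_endComp hxT (hn _ (le_max_right m n))
  have hle : del G T ≤ G := fun a b h => h.1
  have hp : ∀ v ∈ (p.mapLe hle).support, v ∉ T := fun v hv => by
    have hv' : v ∈ p.support := by simpa using hv
    exact notMem_of_mem_endComp (mem_endComp_of_reachable hxT ⟨p.takeUntil v hv'⟩)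
  rcases exists_walk_from_separator (p.mapLe hle) (hR.endComp_subset hS' hSS' hy) hp with
    hC | ⟨a, ha, q, hq⟩
  · exact absurd (hC x (by simp)) hxS
  · obtain ⟨b, hb, r, hr⟩ := exists_walk_to_separator q (hSS'.notMem_of_mem_left ha) hy hq
    exact ⟨a, ha, b, hb, r, hr⟩

/-- A minimum separator `S` of `X` from the end of `R` can be linked to a later separator `S'` by
disjoint paths, given by their successor function on a finite vertex set `U`. -/
theorem IsRay.exists_separator_linkage {G : SimpleGraph V} {R : ℕ → V} (hR : IsRay G R)
    {X : Set V} {S S' : Finset V} (hX : Disjoint X (endComp G R S))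
    (hmin : ∀ T : Finset V, Disjoint X (endComp G R T) → S.card ≤ T.card)
    (hSS' : Disjoint (S : Set V) (endComp G R S')) :
    ∃ (U : Finset V) (f : V → V), S ⊆ U ∧
      (∀ v ∈ U, (v ∈ S ∨ v ∈ endComp G R S) ∧ v ∉ endComp G R S') ∧
      Set.InjOn f {v | v ∈ U ∧ v ∉ S'} ∧
      ∀ v ∈ U, v ∉ S' → f v ∈ U ∧ f v ∉ S ∧ (f v = v ∨ G.Adj v (f v)) := by
  classical
  let P : Set (Finset V) := {P | ∃ a ∈ S, ∃ b ∈ S', ∃ p : G.Walk a b,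
    P = p.support.toFinset ∧
    ∀ v ∈ p.support, (v ∈ S ∨ v ∈ endComp G R S) ∧ v ∉ endComp G R S'}
  obtain ⟨U, hU⟩ := exists_finset_forall_disjoint P S.card (by
    intro T hT
    obtain ⟨x, hxX, hxT⟩ := Set.not_disjoint_iff.1 fun h => absurd (hmin T h) (by omega)
    obtain ⟨a, ha, b, hb, p, hp⟩ := hR.exists_walk_between S'.finite_toSet T.finite_toSet hSS'
      (hX.notMem_of_mem_left hxX) hxT
    refine ⟨p.support.toFinset, ⟨a, ha, b, hb, p, rfl, fun v hv => ?_⟩, ?_⟩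
    · exact ⟨(hp v hv).1.1, (hp v hv).2⟩
    · exact Finset.disjoint_left.2 fun v hv => (hp v (by simpa using hv)).1.2)
  let U' := S ∪ U.filter fun v => (v ∈ S ∨ v ∈ endComp G R S) ∧ v ∉ endComp G R S'
  obtain ⟨f, hf, hf'⟩ := exists_linkage G U' S S' (by
    intro T hT
    obtain ⟨_, ⟨a, ha, b, hb, p, rfl, hp⟩, hpU, hpT⟩ := hU T hT
    refine ⟨a, ha, b, hb, p, fun v hv => ⟨?_, ?_⟩⟩
    · exact Finset.mem_union_right _
        (Finset.mem_filter.2 ⟨hpU (List.mem_toFinset.2 hv), hp v hv⟩)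
    · exact Finset.disjoint_left.1 hpT (List.mem_toFinset.2 hv))
  refine ⟨U', f, Finset.subset_union_left, fun v hv => ?_, hf, hf'⟩
  rcases Finset.mem_union.1 hv with hv | hv
  · exact ⟨Or.inl hv, hSS'.notMem_of_mem_left hv⟩
  · exact (Finset.mem_filter.1 hv).2

theorem iterate_eq_iterate_of_injOn {F : V → V} {A B : Set V} (hmaps : Set.MapsTo F B B)
    (hinj : Set.InjOn F B) (hAB : A ⊆ B) (hdisj : ∀ v ∈ B, F v ∉ A) {a b : V} (ha : a ∈ A)
    (hb : b ∈ A) {m n : ℕ} (h : F^[m] a = F^[n] b) : m = n ∧ a = b := by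
  induction m generalizing n with
  | zero =>
    cases n with
    | zero => exact ⟨rfl, h⟩
    | succ n =>
      rw [Function.iterate_succ_apply'] at h
      exact absurd (h ▸ ha) (hdisj _ (hmaps.iterate n (hAB hb)))
  | succ m ih =>
    cases n with
    | zero =>
      rw [Function.iterate_succ_apply'] at h
      exact absurd (h.symm ▸ hb) (hdisj _ (hmaps.iterate m (hAB ha)))
    | succ n =>
      rw [Function.iterate_succ_apply', Function.iterate_succ_apply'] at h
      obtain ⟨rfl, rfl⟩ :=
        ih (hinj (hmaps.iterate m (hAB ha)) (hmaps.iterate n (hAB hb)) h)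
      exact ⟨rfl, rfl⟩

/-- If the finite set `X₀` cannot be separated from the end of `R` by fewer than `k` vertices, then
this end contains `k` pairwise disjoint rays. -/
theorem IsRay.exists_disjoint_rays {G : SimpleGraph V} {R : ℕ → V} (hR : IsRay G R)
    (hlf : LocFin G) (hconn : G.Connected) (X₀ : Finset V) {k : ℕ} (hk : 0 < k)
    (h : ∀ T : Finset V, Disjoint (X₀ : Set V) (endComp G R T) → k ≤ T.card) :
    ∃ f : Fin k → ℕ → V, (∀ i, IsRay G (f i) ∧ RayEquiv G (f i) R) ∧
      ∀ i j, i ≠ j → Disjoint (Set.range (f i)) (Set.range (f j)) := by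
  classical
  choose sep hsep hmin hbd using hR.exists_min_separator
  let nb : Finset V → Finset V := fun S => S ∪ S.biUnion fun v => (hlf v).toFinset
  let X : ℕ → Finset V := fun n => (fun Y => nb (sep Y))^[n] X₀
  let S : ℕ → Finset V := fun n => sep (X n)
  let C : ℕ → Set V := fun n => endComp G R (S n)
  have hX : ∀ n, X (n + 1) = nb (S n) := fun n => Function.iterate_succ_apply' _ _ _
  have hXC : ∀ n, Disjoint (nb (S n) : Set V) (C (n + 1)) := fun n => hX n ▸ hsep (X (n + 1))
  have hSC : ∀ n, Disjoint (S n : Set V) (C (n + 1)) := fun n =>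
    (hXC n).mono_left (Finset.coe_subset.2 Finset.subset_union_left)
  have hsub : ∀ n, C (n + 1) ⊆ C n := fun n => hR.endComp_subset (S (n + 1)).finite_toSet (hSC n)
  have hanti : Antitone C := antitone_nat_of_succ_le hsub
  have hself : ∀ n, ∀ v ∈ C n, v ∉ S n := fun n v hv => notMem_of_mem_endComp hv
  have hadj : ∀ n, ∀ v ∈ C (n + 1), ∀ w, G.Adj v w → w ∈ C n := by
    intro n v hv w hvw
    refine mem_endComp_of_adj (hsub n hv) hvw fun hw => ?_
    refine (hXC n).notMem_of_mem_right hv (Finset.mem_union_right _ ?_)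
    exact Finset.mem_biUnion.2 ⟨w, hw, by simpa using hvw.symm⟩
  have hSsub : ∀ n, ∀ b ∈ S (n + 1), b ∈ C n := by
    intro n b hb
    obtain ⟨c, hc, hcb⟩ := hbd _ b hb
    exact hadj n c hc b hcb
  choose U f hSU hUC hinj hf using fun n =>
    hR.exists_separator_linkage (hsep (X n)) (hmin (X n)) (hSC n)
  change ∀ n, S n ⊆ U n at hSU
  change ∀ n, ∀ v ∈ U n, (v ∈ S n ∨ v ∈ C n) ∧ v ∉ C (n + 1) at hUC
  change ∀ n, ∀ v ∈ U n, v ∉ S (n + 1) →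
    f n v ∈ U n ∧ f n v ∉ S n ∧ (f n v = v ∨ G.Adj v (f n v)) at hf
  let D : ℕ → Set V := fun n => {v | v ∈ U n ∧ v ∉ S (n + 1)}
  have hSD : ∀ n, ∀ v ∈ S n, v ∈ D n := fun n v hv =>
    ⟨hSU n hv, fun hv' => hself n v (hSsub n v hv') hv⟩
  have hlater : ∀ i j, i < j → ∀ v ∈ U j, v ∈ S (i + 1) ∨ v ∈ C (i + 1) := by
    intro i j hij v hv
    rcases (hUC j v hv).1 with hvS | hvC
    · obtain ⟨l, rfl⟩ := Nat.exists_eq_add_of_lt hij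
      rcases Nat.eq_zero_or_pos l with rfl | hl
      · exact Or.inl hvS
      · exact Or.inr (hanti (by omega) (hSsub _ v hvS))
    · exact Or.inr (hanti hij hvC)
  have hDlt : ∀ i j, i < j → ∀ v ∈ D i, v ∉ D j := by
    intro i j hij v hvi hvj
    rcases hlater i j hij v hvj.1 with hv | hv
    · exact hvi.2 hv
    · exact (hUC i v hvi.1).2 hv
  have hDuniq : ∀ i j v, v ∈ D i → v ∈ D j → i = j := by
    intro i j v hi hj
    rcases lt_trichotomy i j with hij | hij | hij
    · exact absurd hj (hDlt i j hij v hi)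
    · exact hij
    · exact absurd hi (hDlt j i hij v hj)
  let F : V → V := fun v => if hv : ∃ i, v ∈ D i then f hv.choose v else v
  have hF : ∀ i, ∀ v ∈ D i, F v = f i v := by
    intro i v hv
    have hex : ∃ i, v ∈ D i := ⟨i, hv⟩
    simp only [F, dif_pos hex]
    rw [hDuniq _ _ v hex.choose_spec hv]
  have hFC : ∀ i, ∀ v ∈ D i, F v ∈ U i ∧ F v ∈ C i ∧ F v ∉ C (i + 1) := by
    intro i v hv
    obtain ⟨h1, h2, -⟩ := hf i v hv.1 hv.2
    rw [hF i v hv]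
    exact ⟨h1, (hUC i _ h1).1.resolve_left h2, (hUC i _ h1).2⟩
  let B : Set V := {v | ∃ i, v ∈ D i}
  have hmaps : Set.MapsTo F B B := by
    rintro v ⟨i, hv⟩
    by_cases hS : F v ∈ S (i + 1)
    · exact ⟨i + 1, hSD _ _ hS⟩
    · exact ⟨i, (hFC i v hv).1, hS⟩
  have hFinj : Set.InjOn F B := by
    rintro v ⟨i, hv⟩ w ⟨j, hw⟩ hvw
    have h1 := hFC i v hv
    have h2 := hFC j w hw
    rw [← hvw] at h2
    have hij : i = j := by
      rcases lt_trichotomy i j with hij | hij | hij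
      · exact absurd (hanti hij h2.2.1) h1.2.2
      · exact hij
      · exact absurd (hanti hij h1.2.1) h2.2.2
    subst hij
    rw [hF i v hv, hF i w hw] at hvw
    exact hinj i hv hw hvw
  have hSB : (S 0 : Set V) ⊆ B := fun v hv => ⟨0, hSD 0 v hv⟩
  have hFS : ∀ v ∈ B, F v ∉ (S 0 : Set V) := by
    rintro v ⟨i, hv⟩
    exact hself 0 _ (hanti (Nat.zero_le i) (hFC i v hv).2.1)
  have hray : ∀ a ∈ S 0, IsRay G fun n => F^[n] a := by
    intro a ha
    have hai : Function.Injective fun n => F^[n] a := fun m n hmn =>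
      (iterate_eq_iterate_of_injOn hmaps hFinj hSB hFS ha ha hmn).1
    refine ⟨hai, fun n => ?_⟩
    obtain ⟨i, hi⟩ := hmaps.iterate n (hSB ha)
    have hne : F (F^[n] a) ≠ F^[n] a := fun he => by
      rw [← Function.iterate_succ_apply' F n a] at he
      exact absurd (hai he) (by omega)
    have hstep := (hf i _ hi.1 hi.2).2.2
    rw [← hF i _ hi] at hstep
    simpa only [Function.iterate_succ_apply'] using hstep.resolve_left hne
  have hk' : k ≤ (S 0).card := h _ (hsep X₀)
  obtain ⟨s, hs⟩ := Finset.card_pos.1 (hk.trans_le hk')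
  have hfar : ∀ v t : V, ∀ p : G.Walk v t, t ∈ S 0 → v ∉ C p.length := by
    intro v t p ht
    induction p with
    | nil => exact fun hv => hself 0 _ hv ht
    | cons hvw p ih => exact fun hv => ih ht (hadj _ _ hv _ hvw)
  have hshrink : ∀ T : Set V, T.Finite → ∃ n, Disjoint T (C n) := by
    intro T hT
    choose N hN using fun v => (⟨_, hfar v s (hconn.preconnected v s).some hs⟩ : ∃ n, v ∉ C n)
    obtain ⟨M, hM⟩ := (hT.image N).bddAbove
    exact ⟨M, Set.disjoint_left.2 fun v hv hvM =>
      hN v (hanti (hM (Set.mem_image_of_mem N hv)) hvM)⟩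
  have hequiv : ∀ a ∈ S 0, RayEquiv G (fun n => F^[n] a) R := by
    intro a ha T hT
    obtain ⟨n, hn⟩ := hshrink T hT
    obtain ⟨m, hm⟩ := (hray a ha).exists_tail_notMem
      ((Finset.range (n + 1)).biUnion U).finite_toSet
    have hmC : ∀ i, m ≤ i → F^[i] a ∈ C n := by
      intro i hi
      obtain ⟨j, hj⟩ := hmaps.iterate i (hSB ha)
      have hnj : n < j := by
        by_contra hjn
        refine hm i hi (Finset.mem_coe.2 (Finset.mem_biUnion.2 ⟨j, ?_, hj.1⟩))
        exact Finset.mem_range.2 (by omega)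
      rcases hlater n j hnj _ hj.1 with hv | hv
      · exact hSsub n _ hv
      · exact hsub n hv
    obtain ⟨l, hl⟩ := hR.exists_tail_mem_endComp (S n).finite_toSet
    exact ⟨m, l, fun i hi => hn.notMem_of_mem_right (hmC i hi),
      fun i hi => hn.notMem_of_mem_right (hl i hi),
      hR.reachable_of_disjoint hn (hmC m le_rfl) (hl l le_rfl)⟩
  let e : Fin k → V := fun i => (S 0).equivFin.symm (Fin.castLE hk' i)
  have he : ∀ i, e i ∈ S 0 := fun i => ((S 0).equivFin.symm (Fin.castLE hk' i)).2
  refine ⟨fun i n => F^[n] (e i), fun i => ⟨hray _ (he i), hequiv _ (he i)⟩, fun i j hij => ?_⟩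
  refine Set.disjoint_left.2 ?_
  rintro _ ⟨m, rfl⟩ ⟨n, hmn⟩
  have hee := (iterate_eq_iterate_of_injOn hmaps hFinj hSB hFS (he j) (he i) hmn).2
  simp only [e, Subtype.val_inj, EmbeddingLike.apply_eq_iff_eq, Fin.castLE_inj] at hee
  exact hij hee.symm

section BoxProd

variable {G : SimpleGraph V} {D : SimpleGraph W} {T : Set V}

theorem del_reachable_fst {x y : V × W}
    (h : (del (G.boxProd D) (Prod.fst ⁻¹' T)).Reachable x y) :
    (del G T).Reachable x.1 y.1 := by
  obtain ⟨p⟩ := h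
  induction p with
  | nil => exact Reachable.refl _
  | @cons x w y h p ih =>
    refine Reachable.trans ?_ ih
    rcases boxProd_adj.1 h.1 with hG | hD
    · have h' : (del G T).Adj x.1 w.1 := ⟨hG.1, h.2.1, h.2.2⟩
      exact h'.reachable
    · rw [hD.2]

theorem del_reachable_prodMk {S : Set (V × W)} (hS : ∀ x ∈ S, x.1 ∈ T) {u v : V} (hu : u ∉ T)
    (hD : D.Connected) (h : (del G T).Reachable u v) (d e : W) :
    (del (G.boxProd D) S).Reachable (u, d) (v, e) := by
  have hfib : (del (G.boxProd D) S).Reachable (u, d) (u, e) := by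
    obtain ⟨q⟩ := hD.preconnected d e
    induction q with
    | nil => exact Reachable.refl _
    | @cons a b c hab q ih =>
      have h' : (del (G.boxProd D) S).Adj (u, a) (u, b) :=
        ⟨boxProd_adj.2 (Or.inr ⟨hab, rfl⟩), fun hx => hu (hS _ hx), fun hx => hu (hS _ hx)⟩
      exact h'.reachable.trans ih
  refine hfib.trans ?_
  clear hfib
  obtain ⟨p⟩ := h
  induction p with
  | nil => exact Reachable.refl _
  | @cons a b c hab p ih =>
    have h' : (del (G.boxProd D) S).Adj (a, e) (b, e) :=
      ⟨boxProd_adj.2 (Or.inl ⟨hab.1, rfl⟩), fun hx => hu (hS _ hx), fun hx => hab.2.2 (hS _ hx)⟩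
    exact h'.reachable.trans (ih hab.2.2)

theorem IsRay.prodMk {R : ℕ → V} (hR : IsRay G R) (d : W) :
    IsRay (G.boxProd D) fun n => (R n, d) :=
  ⟨fun _ _ h => hR.1 (Prod.ext_iff.1 h).1, fun n => boxProd_adj.2 (Or.inl ⟨hR.2 n, rfl⟩)⟩

theorem RayEquiv.prodMk {R₁ R₂ : ℕ → V} (h : RayEquiv G R₁ R₂) (hD : D.Connected) (d e : W) :
    RayEquiv (G.boxProd D) (fun n => (R₁ n, d)) fun n => (R₂ n, e) := by
  intro S hS
  obtain ⟨m, n, hm, hn, hr⟩ := h (Prod.fst '' S) (hS.image _)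
  have hS' : ∀ x ∈ S, x.1 ∈ Prod.fst '' S := fun x hx => Set.mem_image_of_mem _ hx
  exact ⟨m, n, fun i hi hx => hm i hi (hS' _ hx), fun i hi hx => hn i hi (hS' _ hx),
    del_reachable_prodMk hS' (hm m le_rfl) hD hr d e⟩

/-- A ray of the product in the end of `R × {d}` which avoids the fibres over `T` starts in a fibre
over the component of `G − T` belonging to the end of `R`. -/
theorem fst_mem_endComp [Finite W] {R : ℕ → V} {d : W} {g : ℕ → V × W}
    (hg : IsRay (G.boxProd D) g) (hgR : RayEquiv (G.boxProd D) g fun n => (R n, d))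
    (hT : T.Finite) (hgT : ∀ n, (g n).1 ∉ T) : (g 0).1 ∈ endComp G R T := by
  obtain ⟨m, n, -, hn, hr⟩ := hgR (Prod.fst ⁻¹' T) (by
    rw [← Set.prod_univ]
    exact hT.prod Set.finite_univ)
  exact ⟨n, hn, del_reachable_fst ((hg.del_reachable (fun i _ => hgT i) (Nat.zero_le m)).trans hr)⟩

theorem card_le_of_separator [Finite W] {R : ℕ → V} {d : W} {N : ℕ} {g : Fin N → ℕ → V × W}
    (hg : ∀ i, IsRay (G.boxProd D) (g i) ∧ RayEquiv (G.boxProd D) (g i) fun n => (R n, d))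
    (hdisj : ∀ i j, i ≠ j → Disjoint (Set.range (g i)) (Set.range (g j))) (T : Finset V)
    (hT : ∀ i, (g i 0).1 ∉ endComp G R T) : N ≤ T.card * Nat.card W := by
  have hmeet : ∀ i, ∃ n, (g i n).1 ∈ T := by
    intro i
    by_contra! hi
    exact hT i (fst_mem_endComp (hg i).1 (hg i).2 T.finite_toSet hi)
  choose n hn using hmeet
  have hinj : Function.Injective fun i => ((⟨(g i (n i)).1, hn i⟩, (g i (n i)).2) : T × W) := by
    intro i j hij
    by_contra hne
    simp only [Prod.mk.injEq, Subtype.mk.injEq] at hij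
    exact Set.disjoint_left.1 (hdisj i j hne) ⟨n i, rfl⟩ ⟨n j, (Prod.ext hij.1 hij.2).symm⟩
  simpa [Nat.card_prod] using Nat.card_le_card_of_injective _ hinj

end BoxProd

/-- For `G` infinite locally finite connected, `D` finite connected, an end
`α` of `G` represented by the ray `R`, and the end `α'` of `G □ D` represented by the
copy of `R` in `G × {d₀}`, one has `d(α') = d(α) · |V(D)|`. -/
theorem endDegree_boxProd {V : Type u} {W : Type w} (G : SimpleGraph V)
    (hinf : Infinite V) (hlf : LocFin G) (hconn : G.Connected)
    (D : SimpleGraph W) (hWfin : Finite W) (hDconn : D.Connected) (d₀ : W)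
    (R : ℕ → V) (hR : IsRay G R) :
    endDegree (G.boxProd D) (fun n => (R n, d₀)) =
      endDegree G R * (Nat.card W : ℕ∞) := by
  have hW : Nat.card W ≠ 0 := Nat.card_ne_zero.2 ⟨⟨d₀⟩, hWfin⟩
  apply le_antisymm
  · refine iSup₂_le fun N ⟨g, hg, hdisj⟩ => ?_
    rcases eq_or_ne (endDegree G R) ⊤ with htop | htop
    · rw [htop, ENat.top_mul (by exact_mod_cast hW)]
      exact le_top
    obtain ⟨k, hk⟩ := ENat.ne_top_iff_exists.1 htop
    have hno : ¬ ∃ f : Fin (k + 1) → ℕ → V, (∀ i, IsRay G (f i) ∧ RayEquiv G (f i) R) ∧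
        ∀ i j, i ≠ j → Disjoint (Set.range (f i)) (Set.range (f j)) := by
      intro hf
      have hle : ((k + 1 : ℕ) : ℕ∞) ≤ endDegree G R :=
        le_iSup₂ (f := fun (n : ℕ) (_ : n ∈ {n : ℕ | ∃ f : Fin n → ℕ → V,
          (∀ i, IsRay G (f i) ∧ RayEquiv G (f i) R) ∧
          ∀ i j, i ≠ j → Disjoint (Set.range (f i)) (Set.range (f j))}) => (n : ℕ∞)) (k + 1) hf
      rw [← hk, Nat.cast_le] at hle
      omega
    classical
    have hsep : ∃ T : Finset V, Disjoint ((Finset.univ.image fun i => (g i 0).1 : Finset V) : Set V)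
        (endComp G R T) ∧ T.card < k + 1 := by
      by_contra! hT
      exact hno (hR.exists_disjoint_rays hlf hconn _ k.succ_pos hT)
    obtain ⟨T, hT, hTk⟩ := hsep
    have hN := card_le_of_separator hg hdisj T fun i =>
      hT.notMem_of_mem_left (by simp)
    rw [← hk]
    exact_mod_cast hN.trans (Nat.mul_le_mul_right _ (Nat.le_of_lt_succ hTk))
  · rw [endDegree, ENat.iSup_mul]
    refine iSup_le fun n => ?_
    rw [ENat.iSup_mul]
    refine iSup_le fun ⟨f, hf, hdisj⟩ => ?_
    rw [← Nat.cast_mul]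
    let e : Fin (n * Nat.card W) ≃ Fin n × W :=
      finProdFinEquiv.symm.trans ((Equiv.refl _).prodCongr (Finite.equivFin W).symm)
    refine le_iSup₂ (f := fun (m : ℕ) (_ : m ∈ {m : ℕ | ∃ f : Fin m → ℕ → V × W,
      (∀ i, IsRay (G.boxProd D) (f i) ∧ RayEquiv (G.boxProd D) (f i) fun n => (R n, d₀)) ∧
      ∀ i j, i ≠ j → Disjoint (Set.range (f i)) (Set.range (f j))}) => (m : ℕ∞)) _
      ⟨fun i t => (f (e i).1 t, (e i).2), fun i => ⟨(hf _).1.prodMk _, (hf _).2.prodMk hDconn _ _⟩,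
        fun i j hij => Set.disjoint_left.2 ?_⟩
    rintro _ ⟨s, rfl⟩ ⟨t, hst⟩
    obtain ⟨h1, h2⟩ := Prod.ext_iff.1 hst
    by_cases hfst : (e i).1 = (e j).1
    · exact hij (e.injective (Prod.ext hfst h2.symm))
    · exact Set.disjoint_left.1 (hdisj _ _ hfst) ⟨s, rfl⟩ ⟨t, h1⟩

end IGraph
end
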